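/- There exists an absolute constant C > 0 such that for every sequence λ = (λ_{IJ}) and every finitely supported sequence A = (A_{IJ}) of reals indexed by pairs of dyadic intervals, Σ_{I,J} |λ_{IJ}| |A_{IJ}| ≤ C ‖λ‖_{BMO_prod} ‖s_A‖_{L¹(ℝ²)}, where s_A := (Σ_{I,J} |A_{IJ}|² 1_{I×J}/(|I||J|))^{1/2}. -/

import Mathlib

open MeasureTheory
open scoped ENNReal

noncomputable section

/-- A sequence `λ = (λ_{IJ})` indexed by pairs of dyadic intervals; a dyadic interval
`[2^{-i}k, 2^{-i}(k+1))` is encoded by the pair `(i, k) : ℤ × ℤ`. -/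
abbrev ParaSeq := (ℤ × ℤ) → (ℤ × ℤ) → ℝ

/-- The dyadic interval `[2^{-i} k, 2^{-i}(k+1))` encoded by the pair `p = (i, k) : ℤ × ℤ`. -/
def dyadic (p : ℤ × ℤ) : Set ℝ := Set.Ico ((2:ℝ) ^ (-p.1) * p.2) ((2:ℝ) ^ (-p.1) * (p.2 + 1))

/-- The length `|I| = 2^{-i}` of the dyadic interval encoded by `p = (i, k)`. -/
def dlen (p : ℤ × ℤ) : ℝ := (2:ℝ) ^ (-p.1)

/-- The average `⟨f⟩_I = |I|⁻¹ ∫_I f`. -/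
def avg (f : ℝ → ℝ) (p : ℤ × ℤ) : ℝ := (dlen p)⁻¹ * ∫ x in dyadic p, f x

/-- Admissible families `(u_I)_{I ∈ D}` of `L²(ℝ)` functions: only finitely many nonzero
members and `Σ_I ‖u_I‖₂² = 1`. -/
def Adm : Set ((ℤ × ℤ) → ℝ → ℝ) :=
  {u | (∀ p, MemLp (u p) 2 volume) ∧ {p | u p ≠ 0}.Finite ∧ (∑' p : ℤ × ℤ, ∫ x, (u p x) ^ 2) = 1}

/-- The bilinear sum `Σ_{I,J} λ_{IJ} ⟨g_J⟩_I ⟨u_I⟩_J`. -/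
def pairSum (lam : ParaSeq) (u g : (ℤ × ℤ) → ℝ → ℝ) : ℝ :=
  ∑' pq : (ℤ × ℤ) × (ℤ × ℤ), lam pq.1 pq.2 * avg (g pq.2) pq.1 * avg (u pq.1) pq.2

/-- The norm `‖λ‖_X`, as an element of `[0, ∞]`. -/
def Xnorm (lam : ParaSeq) : ℝ≥0∞ :=
  ⨆ (u : Adm) (g : Adm), ENNReal.ofReal |pairSum lam u.1 g.1|

/-- The norm `‖λ‖_{X'}`, as an element of `[0, ∞]`. -/
def Xprime (lam : ParaSeq) : ℝ≥0∞ :=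
  ⨆ (u : Adm) (g : Adm),
    ENNReal.ofReal
      (∑' pq : (ℤ × ℤ) × (ℤ × ℤ), |lam pq.1 pq.2 * avg (g.1 pq.2) pq.1 * avg (u.1 pq.1) pq.2|)

/-- Admissible sets `Ω` for product BMO: finite positive measure, and every point of `Ω`
lies in a dyadic rectangle contained in `Ω`. -/
def ProdOpen : Set (Set (ℝ × ℝ)) :=
  {Ω | MeasurableSet Ω ∧ 0 < volume Ω ∧ volume Ω < ⊤ ∧
    ∀ z ∈ Ω, ∃ p q : ℤ × ℤ, z ∈ dyadic p ×ˢ dyadic q ∧ dyadic p ×ˢ dyadic q ⊆ Ω}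

/-- The dyadic product BMO norm `‖λ‖_{BMO_prod}`, as an element of `[0, ∞]`. -/
def prodBMO (lam : ParaSeq) : ℝ≥0∞ :=
  ⨆ Ω : ProdOpen,
    ((volume Ω.1)⁻¹ *
      ∑' r : {r : (ℤ × ℤ) × (ℤ × ℤ) // dyadic r.1 ×ˢ dyadic r.2 ⊆ Ω.1},
        ENNReal.ofReal ((lam r.1.1 r.1.2) ^ 2)) ^ (1/2 : ℝ)

/-- The square function `s_A = (Σ_{I,J} |A_{IJ}|² 1_{I×J} / (|I||J|))^{1/2}`. -/
def sqfn (A : ParaSeq) (z : ℝ × ℝ) : ℝ :=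
  Real.sqrt (∑' pq : (ℤ × ℤ) × (ℤ × ℤ),
    (A pq.1 pq.2) ^ 2 * Set.indicator (dyadic pq.1 ×ˢ dyadic pq.2) 1 z / (dlen pq.1 * dlen pq.2))

/-- A finite laminar family of sets, each of which meets `S` in at least a `c`-th of its measure,
has a union of measure at most `c * μ S`. -/
lemma measure_biUnion_le_of_laminar {α ι : Type*} [MeasurableSpace α] (μ : Measure α)
    (F : Finset ι) (f : ι → Set α) (hmeas : ∀ i ∈ F, MeasurableSet (f i))
    (hlam : ∀ i ∈ F, ∀ j ∈ F, Disjoint (f i) (f j) ∨ f i ⊆ f j ∨ f j ⊆ f i)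
    {S : Set α} (hS : MeasurableSet S) (c : ℝ≥0∞) (h : ∀ i ∈ F, μ (f i) ≤ c * μ (S ∩ f i)) :
    μ (⋃ i ∈ F, f i) ≤ c * μ S := by
  classical
  set E : Finset (Set α) := F.image f
  set G : Finset (Set α) := E.filter (Maximal (· ∈ E))
  have hGF : ∀ s ∈ G, ∃ i ∈ F, f i = s := fun s hs =>
    Finset.mem_image.1 (Finset.mem_filter.1 hs).1
  have hsub : (⋃ i ∈ F, f i) ⊆ ⋃ s ∈ G, s := by
    refine Set.iUnion₂_subset fun i hi => ?_
    obtain ⟨t, hit, ht⟩ := E.exists_le_maximal (Finset.mem_image_of_mem f hi)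
    exact hit.trans (Set.subset_biUnion_of_mem (u := fun s : Set α => s)
      (Finset.mem_filter.2 ⟨ht.prop, ht⟩))
  have hdisj : Set.PairwiseDisjoint (G : Set (Set α)) fun s => S ∩ s := by
    intro s hs t ht hst
    obtain ⟨i, hi, rfl⟩ := hGF s hs
    obtain ⟨j, hj, rfl⟩ := hGF t ht
    have hs' := (Finset.mem_filter.1 hs).2
    have ht' := (Finset.mem_filter.1 ht).2
    rcases hlam i hi j hj with h | h | h
    · exact h.mono Set.inter_subset_right Set.inter_subset_right
    · exact absurd (hs'.eq_of_le ht'.prop h) hst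
    · exact absurd (ht'.eq_of_le hs'.prop h).symm hst
  calc μ (⋃ i ∈ F, f i) ≤ μ (⋃ s ∈ G, s) := measure_mono hsub
    _ ≤ ∑ s ∈ G, μ s := measure_biUnion_finset_le _ _
    _ ≤ ∑ s ∈ G, c * μ (S ∩ s) := by
        refine Finset.sum_le_sum fun s hs => ?_
        obtain ⟨i, hi, rfl⟩ := hGF s hs
        exact h i hi
    _ = c * μ (⋃ s ∈ G, S ∩ s) := by
        rw [← Finset.mul_sum, measure_biUnion_finset hdisj]
        intro s hs
        obtain ⟨i, hi, rfl⟩ := hGF s hs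
        exact hS.inter (hmeas i hi)
    _ ≤ c * μ S := by
        gcongr
        exact Set.iUnion₂_subset fun s _ => Set.inter_subset_left

lemma dlen_pos (p : ℤ × ℤ) : 0 < dlen p := by unfold dlen; positivity

lemma measurableSet_dyadic (p : ℤ × ℤ) : MeasurableSet (dyadic p) := measurableSet_Ico

lemma volume_dyadic (p : ℤ × ℤ) : volume (dyadic p) = ENNReal.ofReal (dlen p) := by
  rw [dyadic, Real.volume_Ico, dlen]
  congr 1
  ring

lemma dyadic_disjoint_or_subset_of_le {p q : ℤ × ℤ} (h : p.1 ≤ q.1) :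
    Disjoint (dyadic p) (dyadic q) ∨ dyadic q ⊆ dyadic p := by
  obtain ⟨n, hn⟩ := Int.eq_ofNat_of_zero_le (sub_nonneg.2 h)
  have hlen : (2:ℝ) ^ (-p.1) = 2 ^ (-q.1) * 2 ^ n := by
    rw [show -p.1 = -q.1 + (n : ℤ) by omega, zpow_add₀ two_ne_zero, zpow_natCast]
  have hpos : (0:ℝ) < 2 ^ (-q.1) := by positivity
  refine or_iff_not_imp_left.2 fun hd => ?_
  obtain ⟨x, hxp, hxq⟩ := Set.not_disjoint_iff.1 hd
  simp only [dyadic, Set.mem_Ico, hlen, mul_assoc] at hxp hxq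
  have h1 : (2:ℤ) ^ n * p.2 < q.2 + 1 := by
    exact_mod_cast lt_of_mul_lt_mul_left (hxp.1.trans_lt hxq.2) hpos.le
  have h2 : q.2 < (2:ℤ) ^ n * (p.2 + 1) := by
    exact_mod_cast lt_of_mul_lt_mul_left (hxq.1.trans_lt hxp.2) hpos.le
  have h1' : (2:ℝ) ^ n * p.2 ≤ q.2 := by exact_mod_cast Int.lt_add_one_iff.1 h1
  have h2' : (q.2:ℝ) + 1 ≤ 2 ^ n * (p.2 + 1) := by exact_mod_cast h2
  simp only [dyadic, hlen, mul_assoc]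
  exact Set.Ico_subset_Ico (mul_le_mul_of_nonneg_left h1' hpos.le)
    (mul_le_mul_of_nonneg_left h2' hpos.le)

lemma dyadic_laminar (p q : ℤ × ℤ) :
    Disjoint (dyadic p) (dyadic q) ∨ dyadic p ⊆ dyadic q ∨ dyadic q ⊆ dyadic p := by
  rcases le_total p.1 q.1 with h | h
  · exact (dyadic_disjoint_or_subset_of_le h).imp_right Or.inr
  · exact (dyadic_disjoint_or_subset_of_le h).imp (fun hd => hd.symm) Or.inl

/-- The dyadic rectangle `I × J`. -/
def drect (r : (ℤ × ℤ) × (ℤ × ℤ)) : Set (ℝ × ℝ) := dyadic r.1 ×ˢ dyadic r.2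

lemma measurableSet_drect (r : (ℤ × ℤ) × (ℤ × ℤ)) : MeasurableSet (drect r) :=
  (measurableSet_dyadic _).prod (measurableSet_dyadic _)

lemma volume_drect (r : (ℤ × ℤ) × (ℤ × ℤ)) :
    volume (drect r) = ENNReal.ofReal (dlen r.1 * dlen r.2) := by
  rw [drect, Measure.volume_eq_prod, Measure.prod_prod, volume_dyadic, volume_dyadic,
    ENNReal.ofReal_mul (dlen_pos _).le]

lemma drect_subset_biUnion {T : Finset ((ℤ × ℤ) × (ℤ × ℤ))} {r : (ℤ × ℤ) × (ℤ × ℤ)}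
    (hr : r ∈ T) : drect r ⊆ ⋃ r ∈ T, drect r :=
  Set.subset_iUnion₂_of_subset r hr subset_rfl

/-- The points `(x, y)` such that the slice of `U` over `x` fills at least a quarter of some
interval of the family `F` containing `y`. -/
def fiberHull (F : Finset (ℤ × ℤ)) (U : Set (ℝ × ℝ)) : Set (ℝ × ℝ) :=
  ⋃ q ∈ F, {x | volume (dyadic q) ≤ 4 * volume (Prod.mk x ⁻¹' U ∩ dyadic q)} ×ˢ dyadic q

lemma measurable_volume_fiber_inter {U : Set (ℝ × ℝ)} (hU : MeasurableSet U) {J : Set ℝ}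
    (hJ : MeasurableSet J) : Measurable fun x => volume (Prod.mk x ⁻¹' U ∩ J) :=
  measurable_measure_prodMk_left (ν := (volume : Measure ℝ))
    (hU.inter (measurable_snd hJ : MeasurableSet ((Prod.snd : ℝ × ℝ → ℝ) ⁻¹' J)))

lemma measurableSet_fiberHull (F : Finset (ℤ × ℤ)) {U : Set (ℝ × ℝ)} (hU : MeasurableSet U) :
    MeasurableSet (fiberHull F U) :=
  F.measurableSet_biUnion fun q _ => (measurableSet_le measurable_const
    ((measurable_volume_fiber_inter hU (measurableSet_dyadic q)).const_mul 4)).prod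
      (measurableSet_dyadic q)

lemma volume_fiberHull_le (F : Finset (ℤ × ℤ)) {U : Set (ℝ × ℝ)} (hU : MeasurableSet U) :
    volume (fiberHull F U) ≤ 4 * volume U := by
  classical
  rw [Measure.volume_eq_prod, Measure.prod_apply (measurableSet_fiberHull F hU),
    Measure.prod_apply hU, ← lintegral_const_mul _ (measurable_measure_prodMk_left hU)]
  refine lintegral_mono fun x => ?_
  have hx : Prod.mk x ⁻¹' fiberHull F U = ⋃ q ∈ F.filter fun q =>
      volume (dyadic q) ≤ 4 * volume (Prod.mk x ⁻¹' U ∩ dyadic q), dyadic q := by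
    ext y
    simp [fiberHull, and_left_comm, and_assoc]
  rw [hx]
  exact measure_biUnion_le_of_laminar _ _ _ (fun q _ => measurableSet_dyadic q)
    (fun p _ q _ => dyadic_laminar p q) (measurable_prodMk_left hU) 4
    fun q hq => (Finset.mem_filter.1 hq).2

/-- If `U` fills half of a rectangle `I × J`, then the slices over at least a quarter of the points
of `I` fill a quarter of `J`. -/
lemma volume_le_four_mul_of_half_filled {U : Set (ℝ × ℝ)} (hU : MeasurableSet U)
    (r : (ℤ × ℤ) × (ℤ × ℤ)) (h : volume (drect r) ≤ 2 * volume (drect r ∩ U)) :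
    volume (dyadic r.1) ≤ 4 * volume ({x | volume (dyadic r.2) ≤
      4 * volume (Prod.mk x ⁻¹' U ∩ dyadic r.2)} ∩ dyadic r.1) := by
  set I := dyadic r.1 with hI
  set J := dyadic r.2 with hJ
  have hmI : MeasurableSet I := measurableSet_dyadic _
  have hmJ : MeasurableSet J := measurableSet_dyadic _
  set X := {x | volume J ≤ 4 * volume (Prod.mk x ⁻¹' U ∩ J)}
  have hmX : MeasurableSet X := measurableSet_le measurable_const
    ((measurable_volume_fiber_inter hU hmJ).const_mul 4)
  have hIJ : volume (drect r) = volume I * volume J := by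
    rw [drect, Measure.volume_eq_prod, Measure.prod_prod]
  have hup : 4 * volume (drect r ∩ U) ≤ 4 * (volume (X ∩ I) * volume J) + volume I * volume J := by
    rw [Measure.volume_eq_prod, Measure.prod_apply ((measurableSet_drect r).inter hU),
      ← lintegral_const_mul _ (measurable_measure_prodMk_left ((measurableSet_drect r).inter hU))]
    calc ∫⁻ x, 4 * volume (Prod.mk x ⁻¹' (drect r ∩ U))
        ≤ ∫⁻ x, ((X ∩ I).indicator (fun _ => 4 * volume J) x
            + I.indicator (fun _ => volume J) x) := by
          refine lintegral_mono fun x => ?_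
          by_cases hxI : x ∈ I
          · have hfib : Prod.mk x ⁻¹' (drect r ∩ U) = Prod.mk x ⁻¹' U ∩ J := by
              ext y
              simp [drect, ← hI, ← hJ, hxI, and_comm]
            rw [hfib]
            by_cases hxX : x ∈ X
            · simp only [Set.indicator, Set.mem_inter_iff, hxI, hxX, and_self, if_true]
              exact le_add_right (by gcongr; exact Set.inter_subset_right)
            · simp only [Set.indicator, hxI, if_true]
              exact le_add_left (not_le.1 hxX).le
          · have hfib : Prod.mk x ⁻¹' (drect r ∩ U) = ∅ := by
              ext y
              simp [drect, ← hI, hxI]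
            simp [hfib]
      _ = 4 * (volume (X ∩ I) * volume J) + volume I * volume J := by
          rw [lintegral_add_left (measurable_const.indicator (hmX.inter hmI)),
            lintegral_indicator_const (hmX.inter hmI), lintegral_indicator_const hmI]
          ring
  have hIt : volume I ≠ ⊤ := by rw [hI, volume_dyadic]; exact ENNReal.ofReal_ne_top
  have hJt : volume J ≠ ⊤ := by rw [hJ, volume_dyadic]; exact ENNReal.ofReal_ne_top
  have hJ0 : volume J ≠ 0 := by
    rw [hJ, volume_dyadic]
    exact (ENNReal.ofReal_pos.2 (dlen_pos _)).ne'
  have hfin : volume I * volume J ≠ ⊤ := ENNReal.mul_ne_top hIt hJt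
  have hkey : volume I * volume J + volume I * volume J
      ≤ 4 * (volume (X ∩ I) * volume J) + volume I * volume J := by
    refine le_trans ?_ hup
    rw [← hIJ, ← two_mul]
    calc 2 * volume (drect r) ≤ 2 * (2 * volume (drect r ∩ U)) := by gcongr
      _ = 4 * volume (drect r ∩ U) := by ring
  have := ENNReal.le_of_add_le_add_right hfin hkey
  rw [← mul_assoc] at this
  exact (ENNReal.mul_le_mul_iff_left hJ0 hJt).1 this

/-- The rectangles of a finite family that are half filled by `U` cover a set of measure at most
`16 |U|`: a weak form of the boundedness of the strong dyadic maximal function. -/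
lemma volume_biUnion_drect_le {U : Set (ℝ × ℝ)} (hU : MeasurableSet U)
    (T : Finset ((ℤ × ℤ) × (ℤ × ℤ)))
    (h : ∀ r ∈ T, volume (drect r) ≤ 2 * volume (drect r ∩ U)) :
    volume (⋃ r ∈ T, drect r) ≤ 16 * volume U := by
  classical
  set E := fiberHull (T.image Prod.snd) U
  have hE : MeasurableSet E := measurableSet_fiberHull _ hU
  have hE' : MeasurableSet (Prod.swap ⁻¹' E) := measurable_swap hE
  have hswap : ∀ V : Set (ℝ × ℝ), MeasurableSet V →
      volume (Prod.swap ⁻¹' V) = volume V := fun V hV =>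
    (Measure.measurePreserving_swap (μ := (volume : Measure ℝ))
      (ν := (volume : Measure ℝ))).measure_preimage hV.nullMeasurableSet
  set G := fiberHull (T.image Prod.fst) (Prod.swap ⁻¹' E)
  have hsub : (⋃ r ∈ T, drect r) ⊆ Prod.swap ⁻¹' G := by
    refine Set.iUnion₂_subset fun r hr z hz => ?_
    refine Set.mem_iUnion₂.2 ⟨r.1, Finset.mem_image_of_mem _ hr, ?_, hz.1⟩
    refine (volume_le_four_mul_of_half_filled hU r (h r hr)).trans ?_
    gcongr
    intro x hx
    exact Set.mem_iUnion₂.2 ⟨r.2, Finset.mem_image_of_mem _ hr, hx, hz.2⟩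
  calc volume (⋃ r ∈ T, drect r) ≤ volume (Prod.swap ⁻¹' G) := measure_mono hsub
    _ = volume G := hswap G (measurableSet_fiberHull _ hE')
    _ ≤ 4 * volume (Prod.swap ⁻¹' E) := volume_fiberHull_le _ hE'
    _ = 4 * volume E := by rw [hswap E hE]
    _ ≤ 4 * (4 * volume U) := by gcongr; exact volume_fiberHull_le _ hU
    _ = 16 * volume U := by ring

lemma sum_sq_le_prodBMO (lam : ParaSeq) (T : Finset ((ℤ × ℤ) × (ℤ × ℤ))) (hT : T.Nonempty) :
    ∑ r ∈ T, ENNReal.ofReal (lam r.1 r.2 ^ 2)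
      ≤ prodBMO lam ^ 2 * volume (⋃ r ∈ T, drect r) := by
  classical
  set V := ⋃ r ∈ T, drect r
  have hV0 : 0 < volume V := by
    obtain ⟨r, hr⟩ := hT
    refine lt_of_lt_of_le ?_ (measure_mono (drect_subset_biUnion hr))
    rw [volume_drect]
    exact ENNReal.ofReal_pos.2 (mul_pos (dlen_pos _) (dlen_pos _))
  have hVt : volume V < ⊤ := by
    refine (measure_biUnion_finset_le T drect).trans_lt (ENNReal.sum_lt_top.2 fun r _ => ?_)
    rw [volume_drect]
    exact ENNReal.ofReal_lt_top
  have hmem : V ∈ ProdOpen := by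
    refine ⟨T.measurableSet_biUnion fun r _ => measurableSet_drect r, hV0, hVt, fun z hz => ?_⟩
    obtain ⟨r, hr, hzr⟩ := Set.mem_iUnion₂.1 hz
    exact ⟨r.1, r.2, hzr, drect_subset_biUnion hr⟩
  have hTV : ∀ r ∈ T, dyadic r.1 ×ˢ dyadic r.2 ⊆ V := fun r hr => drect_subset_biUnion hr
  set σ := ∑' r : {r : (ℤ × ℤ) × (ℤ × ℤ) // dyadic r.1 ×ˢ dyadic r.2 ⊆ V},
    ENNReal.ofReal ((lam r.1.1 r.1.2) ^ 2)
  have hsum : ∑ r ∈ T, ENNReal.ofReal (lam r.1 r.2 ^ 2) ≤ σ := by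
    have hle := ENNReal.sum_le_tsum (f := fun r :
      {r : (ℤ × ℤ) × (ℤ × ℤ) // dyadic r.1 ×ˢ dyadic r.2 ⊆ V} =>
        ENNReal.ofReal ((lam r.1.1 r.1.2) ^ 2)) (T.subtype _)
    rwa [Finset.sum_subtype_of_mem (fun r => ENNReal.ofReal (lam r.1 r.2 ^ 2)) hTV] at hle
  have hsup : ((volume V)⁻¹ * σ) ^ (1/2 : ℝ) ≤ prodBMO lam :=
    le_iSup (fun Ω : ProdOpen => ((volume Ω.1)⁻¹ *
      ∑' r : {r : (ℤ × ℤ) × (ℤ × ℤ) // dyadic r.1 ×ˢ dyadic r.2 ⊆ Ω.1},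
        ENNReal.ofReal ((lam r.1.1 r.1.2) ^ 2)) ^ (1/2 : ℝ)) ⟨V, hmem⟩
  have hsq : (volume V)⁻¹ * σ ≤ prodBMO lam ^ 2 := by
    have := pow_le_pow_left' hsup 2
    rwa [← ENNReal.rpow_two, ← ENNReal.rpow_mul, one_div, inv_mul_cancel₀ two_ne_zero,
      ENNReal.rpow_one] at this
  refine hsum.trans ?_
  rwa [← ENNReal.div_eq_inv_mul, ENNReal.div_le_iff hV0.ne' hVt.ne] at hsq

lemma sum_mul_le_of_sum_sq_le {ι : Type*} (T : Finset ι) (f g : ι → ℝ≥0∞) (a b V : ℝ≥0∞)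
    (hf : ∑ i ∈ T, f i ^ 2 ≤ a ^ 2 * V) (hg : ∑ i ∈ T, g i ^ 2 ≤ b ^ 2 * V) :
    ∑ i ∈ T, f i * g i ≤ a * b * V := by
  have h := ENNReal.inner_le_Lp_mul_Lq T f g Real.HolderConjugate.two_two
  simp only [ENNReal.rpow_two] at h
  refine h.trans ?_
  calc (∑ i ∈ T, f i ^ 2) ^ (1 / 2 : ℝ) * (∑ i ∈ T, g i ^ 2) ^ (1 / 2 : ℝ)
      ≤ (a ^ 2 * V) ^ (1 / 2 : ℝ) * (b ^ 2 * V) ^ (1 / 2 : ℝ) := by gcongr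
    _ = ((a * b * V) ^ 2) ^ (1 / 2 : ℝ) := by
        rw [← ENNReal.mul_rpow_of_nonneg _ _ (by norm_num)]
        ring_nf
    _ = a * b * V := by
        rw [← ENNReal.rpow_two, ← ENNReal.rpow_mul, one_div, mul_inv_cancel₀ two_ne_zero,
          ENNReal.rpow_one]

lemma sum_zpow_two_le (K : Finset ℤ) :
    ∀ m : ℤ, (∀ k ∈ K, k ≤ m) → ∑ k ∈ K, (2:ℝ) ^ k ≤ 2 ^ (m + 1) := by
  induction K using Finset.induction_on_max with
  | empty =>
    intro m _
    rw [Finset.sum_empty]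
    positivity
  | insert a K hlt ih =>
    intro m hm
    rw [Finset.sum_insert fun ha => lt_irrefl _ (hlt a ha)]
    have h1 := ih (a - 1) fun k hk => by have := hlt k hk; omega
    have h2 : (2:ℝ) ^ (a + 1) ≤ 2 ^ (m + 1) :=
      zpow_le_zpow_right₀ one_le_two (by have := hm a (Finset.mem_insert_self _ _); omega)
    rw [sub_add_cancel] at h1
    rw [zpow_add_one₀ two_ne_zero] at h2
    linarith

lemma sum_zpow_two_lt_le (K : Finset ℤ) {s : ℝ} (hs : 0 ≤ s) :
    ∑ k ∈ K with (2:ℝ) ^ k < s, (2:ℝ) ^ k ≤ 2 * s := by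
  rcases (K.filter fun k => (2:ℝ) ^ k < s).eq_empty_or_nonempty with h | h
  · rw [h, Finset.sum_empty]
    positivity
  · have hm := Finset.max'_mem _ h
    have h1 := sum_zpow_two_le _ (Finset.max' _ h) fun k hk => Finset.le_max' _ k hk
    rw [zpow_add_one₀ two_ne_zero] at h1
    linarith [(Finset.mem_filter.1 hm).2]

lemma sqfn_eq_sqrt_sum {A : ParaSeq} {S : Finset ((ℤ × ℤ) × (ℤ × ℤ))}
    (hS : ∀ r, r ∉ S → A r.1 r.2 = 0) (z : ℝ × ℝ) :
    sqfn A z = √(∑ r ∈ S, (drect r).indicator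
      (fun _ => A r.1 r.2 ^ 2 / (dlen r.1 * dlen r.2)) z) := by
  rw [sqfn, tsum_eq_sum (s := S) fun r hr => by simp [hS r hr]]
  congr 1
  refine Finset.sum_congr rfl fun r _ => ?_
  by_cases hz : z ∈ drect r
  · rw [Set.indicator_of_mem hz, Set.indicator_of_mem (show z ∈ dyadic r.1 ×ˢ dyadic r.2 from hz),
      Pi.one_apply, mul_one]
  · rw [Set.indicator_of_notMem hz,
      Set.indicator_of_notMem (show z ∉ dyadic r.1 ×ˢ dyadic r.2 from hz), mul_zero, zero_div]

section Sqfn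

variable {A : ParaSeq} {S : Finset ((ℤ × ℤ) × (ℤ × ℤ))}

lemma coeff_nonneg (A : ParaSeq) (r : (ℤ × ℤ) × (ℤ × ℤ)) :
    0 ≤ A r.1 r.2 ^ 2 / (dlen r.1 * dlen r.2) :=
  div_nonneg (sq_nonneg _) (mul_pos (dlen_pos _) (dlen_pos _)).le

lemma sqfn_nonneg (A : ParaSeq) (z : ℝ × ℝ) : 0 ≤ sqfn A z := Real.sqrt_nonneg _

lemma measurable_sqfn (hS : ∀ r, r ∉ S → A r.1 r.2 = 0) : Measurable (sqfn A) := by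
  rw [funext (sqfn_eq_sqrt_sum hS)]
  exact (Finset.measurable_sum _ fun r _ =>
    measurable_const.indicator (measurableSet_drect r)).sqrt

lemma sqrt_coeff_le_sqfn (hS : ∀ r, r ∉ S → A r.1 r.2 = 0) {r : (ℤ × ℤ) × (ℤ × ℤ)} (hr : r ∈ S)
    {z : ℝ × ℝ} (hz : z ∈ drect r) : √(A r.1 r.2 ^ 2 / (dlen r.1 * dlen r.2)) ≤ sqfn A z := by
  rw [sqfn_eq_sqrt_sum hS]
  refine Real.sqrt_le_sqrt ?_
  have := Finset.single_le_sum (f := fun r => (drect r).indicator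
      (fun _ => A r.1 r.2 ^ 2 / (dlen r.1 * dlen r.2)) z)
    (fun r _ => Set.indicator_nonneg (fun _ _ => coeff_nonneg A r) z) hr
  simpa only [Set.indicator_of_mem hz] using this

lemma sqfn_le (hS : ∀ r, r ∉ S → A r.1 r.2 = 0) (z : ℝ × ℝ) :
    sqfn A z ≤ √(∑ r ∈ S, A r.1 r.2 ^ 2 / (dlen r.1 * dlen r.2)) := by
  rw [sqfn_eq_sqrt_sum hS]
  exact Real.sqrt_le_sqrt (Finset.sum_le_sum fun r _ =>
    Set.indicator_le_self' (fun _ _ => coeff_nonneg A r) z)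

lemma sum_indicator_le_sqfn_sq (hS : ∀ r, r ∉ S → A r.1 r.2 = 0)
    {T : Finset ((ℤ × ℤ) × (ℤ × ℤ))} (hT : T ⊆ S) (z : ℝ × ℝ) :
    ∑ r ∈ T, (drect r).indicator
      (fun _ => ENNReal.ofReal (A r.1 r.2 ^ 2 / (dlen r.1 * dlen r.2))) z
      ≤ ENNReal.ofReal (sqfn A z ^ 2) := by
  have hnn : ∀ r ∈ S, 0 ≤ (drect r).indicator
      (fun _ => A r.1 r.2 ^ 2 / (dlen r.1 * dlen r.2)) z :=
    fun r _ => Set.indicator_nonneg (fun _ _ => coeff_nonneg A r) z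
  rw [sqfn_eq_sqrt_sum hS, Real.sq_sqrt (Finset.sum_nonneg hnn), ENNReal.ofReal_sum_of_nonneg hnn]
  refine (Finset.sum_le_sum_of_subset hT).trans (Finset.sum_le_sum fun r _ => ?_)
  by_cases hz : z ∈ drect r <;> simp [hz]

/-- The superlevel set `{s_A > 2^k}`. -/
def sqfnLevel (A : ParaSeq) (k : ℤ) : Set (ℝ × ℝ) := {z | (2:ℝ) ^ k < sqfn A z}

lemma measurableSet_sqfnLevel (hS : ∀ r, r ∉ S → A r.1 r.2 = 0) (k : ℤ) :
    MeasurableSet (sqfnLevel A k) :=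
  measurableSet_lt measurable_const (measurable_sqfn hS)

/-- Each rectangle in the support is half filled by a last level set of the square function. -/
lemma exists_last_half_filled_level (hS : ∀ r, r ∉ S → A r.1 r.2 = 0)
    {r : (ℤ × ℤ) × (ℤ × ℤ)} (hr : r ∈ S) (hA : A r.1 r.2 ≠ 0) :
    ∃ k : ℤ, volume (drect r) ≤ 2 * volume (drect r ∩ sqfnLevel A k) ∧
      2 * volume (drect r ∩ sqfnLevel A (k + 1)) < volume (drect r) := by
  have hpos : 0 < volume (drect r) := by
    rw [volume_drect]
    exact ENNReal.ofReal_pos.2 (mul_pos (dlen_pos _) (dlen_pos _))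
  obtain ⟨k, hk, hmax⟩ := Int.exists_greatest_of_bdd
    (P := fun k => volume (drect r) ≤ 2 * volume (drect r ∩ sqfnLevel A k)) (by
      obtain ⟨m, hm⟩ := pow_unbounded_of_one_lt
        (√(∑ r ∈ S, A r.1 r.2 ^ 2 / (dlen r.1 * dlen r.2))) (one_lt_two (α := ℝ))
      refine ⟨m, fun k hk => le_of_not_gt fun hmk => hpos.not_ge ?_⟩
      have hempty : sqfnLevel A k = ∅ := by
        refine Set.eq_empty_of_forall_notMem fun z hz => ?_
        have h1 : (2:ℝ) ^ (m:ℤ) ≤ 2 ^ k := zpow_le_zpow_right₀ one_le_two hmk.le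
        rw [zpow_natCast] at h1
        exact absurd (hz.trans_le (sqfn_le hS z)) (hm.trans_le h1).le.not_gt
      simpa [hempty] using hk) (by
      obtain ⟨n, hn, -⟩ := exists_mem_Ioc_zpow (Real.sqrt_pos.2 (div_pos (pow_pos (abs_pos.2 hA) 2)
        (mul_pos (dlen_pos r.1) (dlen_pos r.2)))) (one_lt_two (α := ℝ))
      rw [sq_abs] at hn
      refine ⟨n, ?_⟩
      have hsub : drect r ⊆ sqfnLevel A n := fun z hz =>
        hn.trans_le (sqrt_coeff_le_sqfn hS hr hz)
      rw [Set.inter_eq_left.2 hsub]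
      exact le_mul_of_one_le_left' one_le_two)
  exact ⟨k, hk, lt_of_not_ge fun h => by have := hmax _ h; omega⟩

/-- The energy of the rectangles that are not half filled by `{s_A > 2^{k+1}}`. -/
lemma sum_sq_le_of_not_half_filled (hS : ∀ r, r ∉ S → A r.1 r.2 = 0)
    {T : Finset ((ℤ × ℤ) × (ℤ × ℤ))} (hT : T ⊆ S) (k : ℤ)
    (h : ∀ r ∈ T, 2 * volume (drect r ∩ sqfnLevel A (k + 1)) < volume (drect r)) :
    ∑ r ∈ T, ENNReal.ofReal (A r.1 r.2 ^ 2)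
      ≤ (3 * ENNReal.ofReal (2 ^ k)) ^ 2 * volume (⋃ r ∈ T, drect r) := by
  set V := ⋃ r ∈ T, drect r
  set W := sqfnLevel A (k + 1)
  have hmW : MeasurableSet W := measurableSet_sqfnLevel hS _
  set c : (ℤ × ℤ) × (ℤ × ℤ) → ℝ≥0∞ :=
    fun r => ENNReal.ofReal (A r.1 r.2 ^ 2 / (dlen r.1 * dlen r.2)) with hc
  have hterm : ∀ r ∈ T, ENNReal.ofReal (A r.1 r.2 ^ 2)
      ≤ 2 * ∫⁻ z in V \ W, (drect r).indicator (fun _ => c r) z := by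
    intro r hr
    have hfin : volume (drect r ∩ W) ≠ ⊤ :=
      ((measure_mono Set.inter_subset_left).trans_lt
        (by rw [volume_drect]; exact ENNReal.ofReal_lt_top)).ne
    have hhalf : volume (drect r) ≤ 2 * volume (drect r \ W) := by
      have hadd := measure_inter_add_sdiff (μ := volume) (drect r) hmW
      have h2 : volume (drect r) + 2 * volume (drect r ∩ W)
          ≤ 2 * volume (drect r \ W) + 2 * volume (drect r ∩ W) := by
        calc _ ≤ volume (drect r) + volume (drect r) := by gcongr; exact (h r hr).le
          _ = _ := by rw [← hadd]; ring
      exact ENNReal.le_of_add_le_add_right (ENNReal.mul_ne_top ENNReal.ofNat_ne_top hfin) h2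
    have hinter : drect r ∩ (V \ W) = drect r \ W := by
      rw [← Set.inter_sdiff_assoc,
        Set.inter_eq_left.2 (drect_subset_biUnion hr)]
    have hd := mul_pos (dlen_pos r.1) (dlen_pos r.2)
    rw [lintegral_indicator_const (measurableSet_drect r),
      Measure.restrict_apply (measurableSet_drect r), hinter]
    calc ENNReal.ofReal (A r.1 r.2 ^ 2) = c r * volume (drect r) := by
          rw [hc, volume_drect, ← ENNReal.ofReal_mul (coeff_nonneg A r), div_mul_cancel₀ _ hd.ne']
      _ ≤ c r * (2 * volume (drect r \ W)) := by gcongr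
      _ = 2 * (c r * volume (drect r \ W)) := by ring
  calc ∑ r ∈ T, ENNReal.ofReal (A r.1 r.2 ^ 2)
      ≤ ∑ r ∈ T, 2 * ∫⁻ z in V \ W, (drect r).indicator (fun _ => c r) z :=
        Finset.sum_le_sum hterm
    _ = 2 * ∫⁻ z in V \ W, ∑ r ∈ T, (drect r).indicator (fun _ => c r) z := by
        rw [← Finset.mul_sum, lintegral_finsetSum _ fun r _ =>
          measurable_const.indicator (measurableSet_drect r)]
    _ ≤ 2 * ∫⁻ _ in V \ W, (2 * ENNReal.ofReal (2 ^ k)) ^ 2 := by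
        gcongr 2 * ?_
        refine setLIntegral_mono measurable_const fun z hz => ?_
        refine (sum_indicator_le_sqfn_sq hS hT z).trans ?_
        rw [ENNReal.ofReal_pow (sqfn_nonneg A z)]
        gcongr
        have hz' : sqfn A z ≤ 2 ^ (k + 1) := not_lt.1 hz.2
        rw [zpow_add_one₀ two_ne_zero, mul_comm] at hz'
        refine (ENNReal.ofReal_le_ofReal hz').trans_eq ?_
        rw [ENNReal.ofReal_mul two_pos.le, ENNReal.ofReal_ofNat]
    _ ≤ 2 * ((2 * ENNReal.ofReal (2 ^ k)) ^ 2 * volume V) := by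
        rw [setLIntegral_const]
        gcongr
        exact Set.sdiff_subset
    _ = 8 * (ENNReal.ofReal (2 ^ k) ^ 2 * volume V) := by ring
    _ ≤ 9 * (ENNReal.ofReal (2 ^ k) ^ 2 * volume V) := by gcongr; norm_num
    _ = (3 * ENNReal.ofReal (2 ^ k)) ^ 2 * volume V := by ring

lemma sum_zpow_mul_volume_sqfnLevel_le (hS : ∀ r, r ∉ S → A r.1 r.2 = 0) (K : Finset ℤ) :
    ∑ k ∈ K, ENNReal.ofReal (2 ^ k) * volume (sqfnLevel A k)
      ≤ 2 * ∫⁻ z, ENNReal.ofReal (sqfn A z) := by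
  have hmeas := measurableSet_sqfnLevel hS
  rw [← lintegral_const_mul _ (measurable_sqfn hS).ennreal_ofReal]
  simp_rw [← lintegral_indicator_const (hmeas _)]
  rw [← lintegral_finsetSum _ fun k _ => measurable_const.indicator (hmeas k)]
  refine lintegral_mono fun z => ?_
  have h := ENNReal.ofReal_le_ofReal (sum_zpow_two_lt_le K (sqfn_nonneg A z))
  rw [ENNReal.ofReal_sum_of_nonneg fun k _ => by positivity, ENNReal.ofReal_mul two_pos.le,
    ENNReal.ofReal_ofNat, Finset.sum_filter] at h
  exact h

end Sqfn

/-- there is an absolute constant `C > 0` such that for every `λ` and every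
finitely supported `A`, `Σ_{I,J} |λ_{IJ}||A_{IJ}| ≤ C ‖λ‖_{BMO_prod} ‖s_A‖_{L¹(ℝ²)}`. -/
theorem abs_pairing_le_prodBMO_sqfn :
    ∃ C : ℝ, 0 < C ∧ ∀ (lam A : ParaSeq),
      (Function.support fun pq : (ℤ × ℤ) × (ℤ × ℤ) => A pq.1 pq.2).Finite →
      ENNReal.ofReal (∑' pq : (ℤ × ℤ) × (ℤ × ℤ), |lam pq.1 pq.2| * |A pq.1 pq.2|) ≤
        ENNReal.ofReal C * prodBMO lam * ∫⁻ z : ℝ × ℝ, ENNReal.ofReal (sqfn A z) := by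
  classical
  refine ⟨96, by norm_num, fun lam A hfin => ?_⟩
  set S := hfin.toFinset
  have hmem : ∀ r, r ∈ S ↔ A r.1 r.2 ≠ 0 := fun r => by simp [S]
  have hS : ∀ r, r ∉ S → A r.1 r.2 = 0 := fun r hr => not_not.1 fun h => hr ((hmem r).2 h)
  have hex : ∀ r, ∃ k : ℤ, r ∈ S → volume (drect r) ≤ 2 * volume (drect r ∩ sqfnLevel A k) ∧
      2 * volume (drect r ∩ sqfnLevel A (k + 1)) < volume (drect r) := by
    intro r
    by_cases hr : r ∈ S
    · obtain ⟨k, hk⟩ := exists_last_half_filled_level hS hr ((hmem r).1 hr)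
      exact ⟨k, fun _ => hk⟩
    · exact ⟨0, fun h => absurd h hr⟩
  choose κ hκ using hex
  have hlevel : ∀ k ∈ S.image κ,
      ∑ r ∈ S with κ r = k, ENNReal.ofReal |lam r.1 r.2| * ENNReal.ofReal |A r.1 r.2|
        ≤ 48 * prodBMO lam * (ENNReal.ofReal (2 ^ k) * volume (sqfnLevel A k)) := by
    intro k hk
    set T := S.filter fun r => κ r = k
    have hT : ∀ r ∈ T, r ∈ S ∧ κ r = k := fun r hr => Finset.mem_filter.1 hr
    have hne : T.Nonempty := by
      obtain ⟨r, hr, hrk⟩ := Finset.mem_image.1 hk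
      exact ⟨r, Finset.mem_filter.2 ⟨hr, hrk⟩⟩
    have hsq : ∀ x : ℝ, ENNReal.ofReal |x| ^ 2 = ENNReal.ofReal (x ^ 2) := fun x => by
      rw [← ENNReal.ofReal_pow (abs_nonneg x), sq_abs]
    have hlam := sum_sq_le_prodBMO lam T hne
    have hA := sum_sq_le_of_not_half_filled hS (Finset.filter_subset _ _ : T ⊆ S) k
      fun r hr => by obtain ⟨h1, rfl⟩ := hT r hr; exact (hκ r h1).2
    have hV := volume_biUnion_drect_le (measurableSet_sqfnLevel hS k) T
      fun r hr => by obtain ⟨h1, rfl⟩ := hT r hr; exact (hκ r h1).1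
    simp_rw [← hsq] at hlam hA
    calc _ ≤ prodBMO lam * (3 * ENNReal.ofReal (2 ^ k)) * volume (⋃ r ∈ T, drect r) :=
          sum_mul_le_of_sum_sq_le T _ _ _ _ _ hlam hA
      _ ≤ prodBMO lam * (3 * ENNReal.ofReal (2 ^ k)) * (16 * volume (sqfnLevel A k)) := by gcongr
      _ = _ := by ring
  rw [tsum_eq_sum (s := S) fun r hr => by simp [hS r hr],
    ENNReal.ofReal_sum_of_nonneg fun r _ => by positivity]
  simp_rw [ENNReal.ofReal_mul (abs_nonneg _)]
  rw [← Finset.sum_fiberwise_of_maps_to (t := S.image κ) fun r hr => Finset.mem_image_of_mem κ hr]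
  calc _ ≤ ∑ k ∈ S.image κ,
        48 * prodBMO lam * (ENNReal.ofReal (2 ^ k) * volume (sqfnLevel A k)) :=
        Finset.sum_le_sum hlevel
    _ ≤ 48 * prodBMO lam * (2 * ∫⁻ z, ENNReal.ofReal (sqfn A z)) := by
        rw [← Finset.mul_sum]
        gcongr
        exact sum_zpow_mul_volume_sqfnLevel_le hS _
    _ = ENNReal.ofReal 96 * prodBMO lam * ∫⁻ z, ENNReal.ofReal (sqfn A z) := by
        rw [ENNReal.ofReal_ofNat]
        ring

end
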